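/- arXiv:2407.00375 — 5 statements merged into one kernel-verified Lean document; each statement's English description precedes it below -/
import Mathlib

section
/- Let D ≥ 1 and n ≥ 1 be naturals, e : Fin D → M a family of vectors, and G : (Fin n → Fin D) → R an alternating function (G changes sign whenever two of its n index arguments are swapped, hence vanishes when two indices coincide). Set A := Σ_{a : Fin n → Fin D} G(a) · ι(e(a₁))·ι(e(a₂))⋯ι(e(aₙ)). Then for every w ∈ M: A·ι(w) + ι(w)·A = (1 + (−1)ⁿ)·A·ι(w) + n · Σ_{a} G(a) · polar Q (e(a₁), w) · ι(e(a₂))⋯ι(e(aₙ)). (This is the content of Lemma 3 of Appendix C, {Γ̃, Γ_α} = (1+(−1)ⁿ) Γ̃ Γ_α + Γ̃_α, for the contraction of a single rank-n antisymmetric tensor with gamma-matrix products.) -/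
/-- Moving a vector from the left to the right of a product of `n + 1` vectors in the Clifford
algebra. -/
theorem CliffordAlgebra.ι_mul_prod_ofFn {R M : Type*} [CommRing R] [AddCommGroup M] [Module R M]
    (Q : QuadraticForm R M) (w : M) {n : ℕ} (v : Fin (n + 1) → M) :
    ι Q w * (List.ofFn fun k => ι Q (v k)).prod
      = (-1 : R) ^ (n + 1) • ((List.ofFn fun k => ι Q (v k)).prod * ι Q w)
        + ∑ k : Fin (n + 1), ((-1 : R) ^ (k : ℕ) * QuadraticMap.polar Q (v k) w) •
            (List.ofFn fun j => ι Q (v (k.succAbove j))).prod := by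
  induction n with
  | zero =>
    simp [ι_mul_ι_comm w (v 0), QuadraticMap.polar_comm Q w, Algebra.algebraMap_eq_smul_one,
      sub_eq_add_neg, add_comm]
  | succ n ih =>
    have hprod (k : Fin (n + 1)) : (List.ofFn fun j => ι Q (v (k.succ.succAbove j))).prod
        = ι Q (v 0) * (List.ofFn fun j => ι Q (v (k.succAbove j).succ)).prod := by
      simp [List.ofFn_succ]
    rw [List.ofFn_succ, List.prod_cons, ← mul_assoc, ι_mul_ι_comm w (v 0), sub_mul, mul_assoc,
      ih fun k => v k.succ, Fin.sum_univ_succ (n := n + 1)]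
    simp only [hprod, Fin.val_zero, pow_zero, one_mul, Fin.succAbove_zero, Fin.val_succ,
      mul_add, mul_smul_comm, Finset.mul_sum, QuadraticMap.polar_comm Q w,
      Algebra.algebraMap_eq_smul_one, smul_mul_assoc, pow_succ, mul_neg, mul_one, neg_mul,
      neg_smul, Finset.sum_neg_distrib, mul_assoc, neg_neg]
    abel

/-- A function of tuples that changes sign under transpositions of the indices is multiplied by
the sign under an arbitrary permutation. -/
theorem comp_perm_eq_sign_mul {ι α R : Type*} [Fintype ι] [DecidableEq ι] [CommRing R]
    {G : (ι → α) → R}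
    (hG : ∀ (a : ι → α) (i j : ι), i ≠ j → G (a ∘ Equiv.swap i j) = -G a)
    (σ : Equiv.Perm ι) (a : ι → α) :
    G (a ∘ σ) = ((Equiv.Perm.sign σ : ℤ) : R) * G a := by
  induction σ using Equiv.Perm.swap_induction_on generalizing a with
  | one => simp
  | swap_mul σ i j hij ih =>
    rw [Equiv.Perm.coe_mul, ← Function.comp_assoc, ih, hG a i j hij]
    simp [Equiv.Perm.sign_swap hij]

/-- Lemma 3 of Appendix C.
Let `D ≥ 1`, `n ≥ 1`, `e : Fin D → M` a family of vectors and
`G : (Fin n → Fin D) → R` alternating.  With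
`A := Σ_a G(a) • ι(e(a₁))⋯ι(e(aₙ))`, for every `w ∈ M`:
`A·ι(w) + ι(w)·A = (1 + (−1)ⁿ)·A·ι(w) + n · Σ_a (G(a) · polar Q (e(a₁), w)) • ι(e(a₂))⋯ι(e(aₙ))`. -/
theorem stmt2 {R M : Type*} [CommRing R] [AddCommGroup M] [Module R M]
    (Q : QuadraticForm R M) (D n : ℕ) (hD : 1 ≤ D) (hn : 1 ≤ n)
    (e : Fin D → M) (G : (Fin n → Fin D) → R)
    (hG : ∀ (a : Fin n → Fin D) (i j : Fin n), i ≠ j →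
      G (a ∘ Equiv.swap i j) = - G a)
    (A : CliffordAlgebra Q)
    (hA : A = ∑ a : Fin n → Fin D,
      G a • (List.ofFn fun k => CliffordAlgebra.ι Q (e (a k))).prod)
    (w : M) :
    A * CliffordAlgebra.ι Q w + CliffordAlgebra.ι Q w * A
      = (1 + (-1 : R) ^ n) • (A * CliffordAlgebra.ι Q w)
        + (n : R) • ∑ a : Fin n → Fin D,
            (G a * QuadraticMap.polar Q (e (a ⟨0, hn⟩)) w) •
              ((List.ofFn fun k => CliffordAlgebra.ι Q (e (a k))).tail).prod := by
  obtain ⟨n, rfl⟩ := Nat.exists_eq_add_of_le' hn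
  have hterm (k : Fin (n + 1)) :
      ∑ a : Fin (n + 1) → Fin D, (G a * ((-1 : R) ^ (k : ℕ) * QuadraticMap.polar Q (e (a k)) w)) •
          (List.ofFn fun j => CliffordAlgebra.ι Q (e (a (k.succAbove j)))).prod
        = ∑ a : Fin (n + 1) → Fin D, (G a * QuadraticMap.polar Q (e (a 0)) w) •
          (List.ofFn fun j : Fin n => CliffordAlgebra.ι Q (e (a j.succ))).prod := by
    refine Fintype.sum_equiv (k.cycleRange.arrowCongr (Equiv.refl (Fin D))) _ _ fun a => ?_
    have hGa : G (a ∘ k.cycleRange.symm) = (-1 : R) ^ (k : ℕ) * G a := by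
      rw [comp_perm_eq_sign_mul hG, Equiv.Perm.sign_symm, Fin.sign_cycleRange]
      simp
    have harrow : k.cycleRange.arrowCongr (Equiv.refl (Fin D)) a = a ∘ k.cycleRange.symm := rfl
    simp only [harrow, hGa, Function.comp_apply, Fin.cycleRange_symm_zero,
      Fin.cycleRange_symm_succ]
    congr 1
    ring
  have hmove : CliffordAlgebra.ι Q w * A = (-1 : R) ^ (n + 1) • (A * CliffordAlgebra.ι Q w)
      + ∑ k : Fin (n + 1), ∑ a : Fin (n + 1) → Fin D,
          (G a * ((-1 : R) ^ (k : ℕ) * QuadraticMap.polar Q (e (a k)) w)) •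
            (List.ofFn fun j => CliffordAlgebra.ι Q (e (a (k.succAbove j)))).prod := by
    rw [Finset.sum_comm, hA, Finset.mul_sum, Finset.sum_mul, Finset.smul_sum,
      ← Finset.sum_add_distrib]
    refine Finset.sum_congr rfl fun a _ => ?_
    rw [mul_smul_comm, CliffordAlgebra.ι_mul_prod_ofFn Q w fun k => e (a k), smul_add,
      Finset.smul_sum, smul_mul_assoc, smul_comm (G a)]
    simp only [smul_smul]
  rw [hmove, Finset.sum_congr rfl fun k _ => hterm k, Finset.sum_const, Finset.card_univ,
    Fintype.card_fin, Nat.cast_smul_eq_nsmul, add_smul (1 : R), one_smul, add_assoc]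
  simp only [List.ofFn_succ, List.tail_cons, Fin.mk_zero']
end

section
/- For every n ≤ d and all indices a₁, …, aₙ ∈ Fin d, the antisymmetrized gamma product times the chirality matrix satisfies Γ^{a₁…aₙ} · Γ^{(d+1)} = (−1)^{d(d−1)/2 + n_t} · i^{d/2 + n_t} · (−1)^{n(n−1)/2} · (1/(d−n)!) · Σ_{b₁,…,b_{d−n} ∈ Fin d} ε^{a₁…aₙ b₁…b_{d−n}} · Γ_{b₁…b_{d−n}}. (Corollary of Appendix C on gamma-matrix duality.) -/
open scoped BigOperators

/-- The ordered product `Γ_{a₁} ⋯ Γ_{a_k}` of gamma matrices. -/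
noncomputable def gammaProd {d N : ℕ} (Γ : Fin d → Matrix (Fin N) (Fin N) ℂ)
    {k : ℕ} (a : Fin k → Fin d) : Matrix (Fin N) (Fin N) ℂ :=
  (List.ofFn fun i => Γ (a i)).prod

/-- The antisymmetrized product
`Γ_{a₁…a_k} := (1/k!) Σ_{π ∈ S_k} sign(π) Γ_{a_{π(1)}} ⋯ Γ_{a_{π(k)}}`. -/
noncomputable def gammaAnti {d N : ℕ} (Γ : Fin d → Matrix (Fin N) (Fin N) ℂ)
    {k : ℕ} (a : Fin k → Fin d) : Matrix (Fin N) (Fin N) ℂ :=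
  ((k.factorial : ℂ)⁻¹) • ∑ π : Equiv.Perm (Fin k),
    (((Equiv.Perm.sign π : ℤ) : ℂ)) • gammaProd Γ (a ∘ π)

/-- The Levi-Civita symbol `ε_{μ₁…μ_d}`: the sign of `(μ₁,…,μ_d)` as a permutation of
`(0,…,d−1)`, and `0` if the indices are not pairwise distinct. -/
noncomputable def levi (d : ℕ) (μ : Fin d → Fin d) : ℂ :=
  ∑ π : Equiv.Perm (Fin d), if μ = ⇑π then (((Equiv.Perm.sign π : ℤ)) : ℂ) else 0

/-- Transposing two neighbouring distinct anticommuting factors flips the sign. -/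
theorem gammaProd_comp_swap {d N : ℕ} {Γ : Fin d → Matrix (Fin N) (Fin N) ℂ}
    (hac : ∀ x y, x ≠ y → Γ x * Γ y = -(Γ y * Γ x)) :
    ∀ {k : ℕ} (a : Fin (k + 1) → Fin d), Function.Injective a → ∀ i : Fin k,
      gammaProd Γ (a ∘ Equiv.swap i.castSucc i.succ) = -gammaProd Γ a := by
  intro k
  induction k with
  | zero => intro a _ i; exact i.elim0
  | succ k ih =>
    intro a ha i
    refine Fin.cases ?_ (fun j => ?_) i
    · have h0 : ∀ j : Fin k, Equiv.swap (0 : Fin (k + 2)) 1 j.succ.succ = j.succ.succ :=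
        fun j => Equiv.swap_apply_of_ne_of_ne (Fin.succ_ne_zero _)
          (fun h => Fin.succ_ne_zero j (Fin.succ_injective _ h))
      have h01 : a 0 ≠ a 1 := fun h => by simpa using ha h
      simp [gammaProd, List.ofFn_succ, h0, ← mul_assoc, hac (a 1) (a 0) h01.symm]
    · have h0 : Equiv.swap j.succ.castSucc j.succ.succ (0 : Fin (k + 2)) = 0 :=
        Equiv.swap_apply_of_ne_of_ne (by simp [Fin.ext_iff]) (Fin.succ_ne_zero _).symm
      have hs : ∀ l : Fin (k + 1), Equiv.swap j.succ.castSucc j.succ.succ l.succ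
          = (Equiv.swap j.castSucc j.succ l).succ := fun l => by
        rw [← Fin.succ_castSucc]
        exact (Fin.succ_injective _).swap_apply _ _ _
      have := ih (a ∘ Fin.succ) (ha.comp (Fin.succ_injective _)) j
      simp only [gammaProd, Function.comp_apply] at this
      simp only [gammaProd, Function.comp_apply, List.ofFn_succ (n := k + 1), h0, hs,
        List.prod_cons, this, mul_neg]

/-- A product of distinct anticommuting matrices is alternating in its indices. -/
theorem gammaProd_comp_perm {d N : ℕ} {Γ : Fin d → Matrix (Fin N) (Fin N) ℂ}
    (hac : ∀ x y, x ≠ y → Γ x * Γ y = -(Γ y * Γ x)) {k : ℕ} (a : Fin k → Fin d)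
    (ha : Function.Injective a) (π : Equiv.Perm (Fin k)) :
    gammaProd Γ (a ∘ π) = ((Equiv.Perm.sign π : ℤ) : ℂ) • gammaProd Γ a := by
  cases k with
  | zero => simp [gammaProd, Subsingleton.elim π 1]
  | succ k =>
    have hπ : π ∈ Submonoid.closure
        (Set.range fun i : Fin k => Equiv.swap i.castSucc i.succ) := by
      rw [Equiv.Perm.mclosure_swap_castSucc_succ]; trivial
    induction hπ using Submonoid.closure_induction_right with
    | one => simp
    | mul_right x hx y hy ih =>
      obtain ⟨i, rfl⟩ := hy
      have := gammaProd_comp_swap hac (a ∘ x) (ha.comp x.injective) i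
      rw [Equiv.Perm.coe_mul, ← Function.comp_assoc, this, ih]
      simp [Equiv.Perm.sign_swap (Fin.castSucc_lt_succ (i := i)).ne]

theorem gammaProd_append {d N : ℕ} (Γ : Fin d → Matrix (Fin N) (Fin N) ℂ) {k n m : ℕ}
    (h : k = n + m) (a : Fin n → Fin d) (b : Fin m → Fin d) :
    gammaProd Γ (fun i : Fin k => Fin.append a b (Fin.cast h i))
      = gammaProd Γ a * gammaProd Γ b := by
  subst h
  have : (fun i : Fin (n + m) => Γ (Fin.append a b i))
      = Fin.append (fun i => Γ (a i)) (fun i => Γ (b i)) := by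
    ext1 i
    refine Fin.addCases (fun j => ?_) (fun j => ?_) i <;> simp
  simp [gammaProd, this, List.ofFn_fin_append]

theorem gammaProd_smul {d N : ℕ} {Γ Γ' : Fin d → Matrix (Fin N) (Fin N) ℂ} {c : Fin d → ℂ}
    (h : ∀ x, Γ' x = c x • Γ x) {k : ℕ} (a : Fin k → Fin d) :
    gammaProd Γ' a = (∏ i, c (a i)) • gammaProd Γ a := by
  induction k with
  | zero => simp [gammaProd]
  | succ k ih =>
    have := ih (a ∘ Fin.succ)
    simp only [gammaProd, Function.comp_apply] at this
    simp only [gammaProd, List.ofFn_succ, List.prod_cons, this, Fin.prod_univ_succ]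
    rw [h, smul_mul_smul_comm]

theorem mul_gammaProd_of_anticommute {d N : ℕ} {Γ : Fin d → Matrix (Fin N) (Fin N) ℂ}
    {M : Matrix (Fin N) (Fin N) ℂ} {k : ℕ} (a : Fin k → Fin d)
    (h : ∀ i, Γ (a i) * M = -(M * Γ (a i))) :
    gammaProd Γ a * M = (-1 : ℂ) ^ k • (M * gammaProd Γ a) := by
  induction k with
  | zero => simp [gammaProd]
  | succ k ih =>
    have := ih (a ∘ Fin.succ) fun i => h i.succ
    simp only [gammaProd, Function.comp_apply] at this
    simp only [gammaProd, List.ofFn_succ, List.prod_cons]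
    rw [mul_assoc, this, mul_smul_comm, ← mul_assoc, h 0, pow_succ]
    simp [mul_assoc]

theorem gammaProd_mul_self {d N : ℕ} {Γ : Fin d → Matrix (Fin N) (Fin N) ℂ} {η : Fin d → ℂ}
    (hac : ∀ x y, x ≠ y → Γ x * Γ y = -(Γ y * Γ x)) (hsq : ∀ x, Γ x * Γ x = η x • 1)
    {k : ℕ} (a : Fin k → Fin d) (ha : Function.Injective a) :
    gammaProd Γ a * gammaProd Γ a
      = ((-1 : ℂ) ^ (k * (k - 1) / 2) * ∏ i, η (a i)) • 1 := by
  induction k with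
  | zero => simp [gammaProd]
  | succ k ih =>
    have h1 := ih (a ∘ Fin.succ) (ha.comp (Fin.succ_injective _))
    have h2 := mul_gammaProd_of_anticommute (Γ := Γ) (M := Γ (a 0)) (a ∘ Fin.succ) fun i =>
      hac _ _ fun h => Fin.succ_ne_zero i (ha h)
    have h3 : gammaProd Γ a = Γ (a 0) * gammaProd Γ (a ∘ Fin.succ) := by
      simp [gammaProd, List.ofFn_succ]
    have h4 : (k + 1) * (k + 1 - 1) / 2 = k + k * (k - 1) / 2 := by
      rw [← Finset.sum_range_id, ← Finset.sum_range_id, Finset.sum_range_succ, add_comm]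
    rw [h3, mul_assoc, ← mul_assoc (gammaProd Γ _) (Γ _), h2, smul_mul_assoc, mul_smul_comm,
      mul_assoc, h1, ← mul_assoc, hsq, h4, Fin.prod_univ_succ, pow_add]
    simp only [Function.comp_apply, mul_smul_comm, mul_one, smul_smul]
    congr 1
    ring

theorem gammaAnti_of_injective {d N : ℕ} {Γ : Fin d → Matrix (Fin N) (Fin N) ℂ}
    (hac : ∀ x y, x ≠ y → Γ x * Γ y = -(Γ y * Γ x)) {k : ℕ} (a : Fin k → Fin d)
    (ha : Function.Injective a) : gammaAnti Γ a = gammaProd Γ a := by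
  have h (π : Equiv.Perm (Fin k)) :
      ((Equiv.Perm.sign π : ℤ) : ℂ) • gammaProd Γ (a ∘ π) = gammaProd Γ a := by
    rw [gammaProd_comp_perm hac a ha, smul_smul, ← Int.cast_mul]
    simp
  have hk : (k.factorial : ℂ) ≠ 0 := by exact_mod_cast k.factorial_ne_zero
  simp [gammaAnti, h, Fintype.card_perm, ← Nat.cast_smul_eq_nsmul ℂ, smul_smul, hk]

theorem gammaAnti_of_not_injective {d N : ℕ} (Γ : Fin d → Matrix (Fin N) (Fin N) ℂ) {k : ℕ}
    (a : Fin k → Fin d) (ha : ¬Function.Injective a) : gammaAnti Γ a = 0 := by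
  simp only [Function.Injective, not_forall] at ha
  obtain ⟨i, j, hij, hne⟩ := ha
  have hs : a ∘ Equiv.swap i j = a := by
    ext1 l
    simp only [Function.comp_apply, Equiv.swap_apply_def]
    split_ifs with h1 h2
    · rw [h1, hij]
    · rw [h2, hij]
    · rfl
  have key := Equiv.sum_comp (Equiv.mulLeft (Equiv.swap i j))
    fun π : Equiv.Perm (Fin k) => ((Equiv.Perm.sign π : ℤ) : ℂ) • gammaProd Γ (a ∘ π)
  simp only [Equiv.coe_mulLeft, Equiv.Perm.coe_mul, ← Function.comp_assoc, hs, map_mul,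
    Equiv.Perm.sign_swap hne, neg_mul, one_mul, Units.val_neg, Int.cast_neg, neg_smul,
    Finset.sum_neg_distrib] at key
  have h2 := (two_smul ℂ _).trans (neg_eq_iff_add_eq_zero.mp key)
  rw [gammaAnti, (smul_eq_zero.mp h2).resolve_left two_ne_zero, smul_zero]

theorem levi_perm {d : ℕ} (σ : Equiv.Perm (Fin d)) :
    levi d σ = ((Equiv.Perm.sign σ : ℤ) : ℂ) := by
  simp [levi, DFunLike.coe_fn_eq]

theorem levi_of_not_injective {d : ℕ} (μ : Fin d → Fin d) (hμ : ¬Function.Injective μ) :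
    levi d μ = 0 :=
  Finset.sum_eq_zero fun π _ => if_neg fun h : μ = π => hμ (h ▸ π.injective)

/-- The Levi-Civita contraction of gamma matrices is `d!` times the ordered product. -/
theorem sum_levi_smul_gammaProd {d N : ℕ} {Γ : Fin d → Matrix (Fin N) (Fin N) ℂ}
    (hac : ∀ x y, x ≠ y → Γ x * Γ y = -(Γ y * Γ x)) :
    ∑ μ : Fin d → Fin d, levi d μ • gammaProd Γ μ = (d.factorial : ℂ) • gammaProd Γ id := by
  have h (π : Equiv.Perm (Fin d)) :
      ((Equiv.Perm.sign π : ℤ) : ℂ) • gammaProd Γ π = gammaProd Γ id := by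
    have := gammaProd_comp_perm hac id Function.injective_id π
    rw [Function.id_comp] at this
    rw [this, smul_smul, ← Int.cast_mul]
    simp
  simp only [levi, Finset.sum_smul, ite_smul, zero_smul]
  rw [Finset.sum_comm]
  simp [h, Fintype.card_perm, ← Nat.cast_smul_eq_nsmul ℂ]

/-- An injective `a : Fin n → Fin d` has `(d - n)!` completions to a permutation. -/
theorem card_filter_injective_append {d n m : ℕ} (h : d = n + m) (a : Fin n → Fin d)
    (ha : Function.Injective a) :
    (Finset.univ.filter fun b : Fin m → Fin d =>
      Function.Injective fun i : Fin d => Fin.append a b (Fin.cast h i)).card = m.factorial := by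
  classical
  have hinj (b : Fin m → Fin d) :
      (Function.Injective fun i : Fin d => Fin.append a b (Fin.cast h i)) ↔
        Function.Injective b ∧ ∀ j, b j ∉ Set.range a := by
    have : (Function.Injective fun i : Fin d => Fin.append a b (Fin.cast h i)) ↔
        Function.Injective (Fin.append a b) :=
      Function.Injective.of_comp_iff' _ (finCongr h).bijective
    rw [this, Fin.append_injective_iff]
    simp only [ha, true_and, Set.mem_range, not_exists]
    exact and_congr_right fun _ => forall_comm
  have e : {b : Fin m → Fin d //
      Function.Injective fun i : Fin d => Fin.append a b (Fin.cast h i)} ≃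
        (Fin m ↪ {x // x ∉ Set.range a}) :=
    { toFun := fun b => ⟨fun j => ⟨b.1 j, ((hinj b.1).1 b.2).2 j⟩, fun i j hij =>
        ((hinj b.1).1 b.2).1 (congrArg Subtype.val hij)⟩
      invFun := fun f => ⟨fun j => f j, (hinj _).2
        ⟨Subtype.val_injective.comp f.injective, fun j => (f j).2⟩⟩
      left_inv := fun _ => rfl
      right_inv := fun _ => rfl }
  have hc : Fintype.card {x // x ∉ Set.range a} = m := by
    rw [Fintype.card_subtype_compl, Fintype.card_fin]
    have : Fintype.card {x // x ∈ Set.range a} = n := by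
      rw [← Nat.card_eq_fintype_card]
      exact (Nat.card_range_of_injective ha).trans (Nat.card_fin n)
    omega
  rw [← Fintype.card_subtype, Fintype.card_congr e, Fintype.card_embedding_eq, hc,
    Fintype.card_fin, Nat.descFactorial_self]

theorem prod_eq_neg_one_pow_card {ι : Type*} [Fintype ι] {η : ι → ℂ}
    (hη : ∀ x, η x = 1 ∨ η x = -1) :
    ∏ x, η x = (-1) ^ (Finset.univ.filter fun x => η x = -1).card := by
  rw [← Finset.prod_const, Finset.prod_filter]
  refine Finset.prod_congr rfl fun x _ => ?_
  split_ifs with h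
  · exact h
  · exact (hη x).resolve_right h

/-- gamma-matrix duality, Corollary of Appendix C.
For even `d`, a sign function `η` taking the value `−1` exactly `n_t` times, a
gamma-matrix representation `Γ` with raised matrices `Γ^a = η(a) Γ_a` and chirality
matrix `Γ^{(d+1)} = (−i)^{d/2+n_t} (1/d!) Σ ε_{μ₁…μ_d} Γ^{μ₁}⋯Γ^{μ_d}`, for every
`n ≤ d` and indices `a₁,…,aₙ`:
`Γ^{a₁…aₙ} Γ^{(d+1)} = (−1)^{d(d−1)/2+n_t} i^{d/2+n_t} (−1)^{n(n−1)/2} (1/(d−n)!)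
   Σ_b ε^{a₁…aₙb₁…b_{d−n}} Γ_{b₁…b_{d−n}}`,
where `ε^{…} = (−1)^{n_t} ε_{…}`. -/
theorem stmt4 {d N : ℕ} (hd : Even d) (η : Fin d → ℂ)
    (hη : ∀ a, η a = 1 ∨ η a = -1)
    (nt : ℕ) (hnt : nt = (Finset.univ.filter fun a => η a = -1).card)
    (Γ : Fin d → Matrix (Fin N) (Fin N) ℂ)
    (hΓ : ∀ a b, Γ a * Γ b + Γ b * Γ a = if a = b then (2 * η a) • 1 else 0)
    (Γup : Fin d → Matrix (Fin N) (Fin N) ℂ) (hΓup : ∀ a, Γup a = η a • Γ a)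
    (chir : Matrix (Fin N) (Fin N) ℂ)
    (hchir : chir = ((-Complex.I) ^ (d / 2 + nt) * ((d.factorial : ℂ))⁻¹) •
      ∑ μ : Fin d → Fin d, levi d μ • gammaProd Γup μ)
    (n : ℕ) (hn : n ≤ d) (a : Fin n → Fin d) :
    gammaAnti Γup a * chir
      = ((-1 : ℂ) ^ (d * (d - 1) / 2 + nt) * Complex.I ^ (d / 2 + nt)
          * (-1 : ℂ) ^ (n * (n - 1) / 2) * ((d - n).factorial : ℂ)⁻¹) •
        ∑ b : Fin (d - n) → Fin d,
          ((-1 : ℂ) ^ nt *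
              levi d (fun i => Fin.append a b (Fin.cast (show d = n + (d - n) by omega) i))) •
            gammaAnti Γ b := by
  have hsq (x) : Γ x * Γ x = η x • 1 := by
    have := hΓ x x
    rw [if_pos rfl, ← two_smul ℂ, mul_smul] at this
    exact smul_right_injective _ (two_ne_zero (α := ℂ)) this
  have hac (x y) (hxy : x ≠ y) : Γ x * Γ y = -(Γ y * Γ x) := by
    have := hΓ x y
    rw [if_neg hxy] at this
    exact eq_neg_of_add_eq_zero_left this
  have hηη (x) : η x * η x = 1 := by rcases hη x with h | h <;> simp [h]
  have hsq' (x) : Γup x * Γup x = η x • 1 := by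
    simp [hΓup, hsq, smul_smul, hηη]
  have hac' (x y) (hxy : x ≠ y) : Γup x * Γup y = -(Γup y * Γup x) := by
    simp [hΓup, hac x y hxy, smul_smul, mul_comm]
  have hdn : d = n + (d - n) := by omega
  have hfac (k : ℕ) : (k.factorial : ℂ) ≠ 0 := by exact_mod_cast k.factorial_ne_zero
  have hone : ((-1 : ℂ) ^ (n * (n - 1) / 2)) * (-1 : ℂ) ^ (n * (n - 1) / 2) = 1 := by
    rw [← mul_pow]
    simp
  have hsign (σ : Equiv.Perm (Fin d)) :
      ((Equiv.Perm.sign σ : ℤ) : ℂ) * ((Equiv.Perm.sign σ : ℤ) : ℂ) = 1 := by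
    rw [← Int.cast_mul]
    simp
  rw [sum_levi_smul_gammaProd hac', smul_smul, mul_assoc, inv_mul_cancel₀ (hfac d),
    mul_one] at hchir
  by_cases ha : Function.Injective a
  swap
  · rw [gammaAnti_of_not_injective Γup a ha, zero_mul, Finset.sum_eq_zero, smul_zero]
    intro b _
    rw [levi_of_not_injective, mul_zero, zero_smul]
    intro h
    refine ha fun i j hij => Fin.castAdd_injective _ _ (Fin.cast_injective hdn.symm (h ?_))
    simpa using hij
  have hphase : (-Complex.I) ^ (d / 2 + nt)
      = (-1 : ℂ) ^ (d * (d - 1) / 2 + nt) * Complex.I ^ (d / 2 + nt) := by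
    obtain ⟨r, rfl⟩ := hd
    have h1 : (r + r) / 2 = r := by omega
    have h2 : (r + r) * (r + r - 1) / 2 = r * (r + r - 1) := by
      rw [← two_mul, mul_assoc, Nat.mul_div_cancel_left _ two_pos]
    rw [neg_pow, h1, h2, pow_add, pow_add (-1 : ℂ) (r * _)]
    congr 2
    rcases r.eq_zero_or_pos with rfl | hr
    · simp
    · have hodd : Odd (r + r - 1) := ⟨r - 1, by omega⟩
      rw [mul_comm r, pow_mul, hodd.neg_one_pow]
  have hterm (b : Fin (d - n) → Fin d) :
      ((-1 : ℂ) ^ nt * levi d (fun i => Fin.append a b (Fin.cast hdn i))) • gammaAnti Γ b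
        = if Function.Injective fun i : Fin d => Fin.append a b (Fin.cast hdn i) then
            (-1 : ℂ) ^ (n * (n - 1) / 2) • (gammaProd Γup a * gammaProd Γup id) else 0 := by
    split_ifs with hinj
    swap
    · rw [levi_of_not_injective _ hinj, mul_zero, zero_smul]
    have hb : Function.Injective b := by
      intro i j hij
      refine Fin.natAdd_injective _ _ (Fin.cast_injective hdn.symm (hinj ?_))
      simpa using hij
    let σ : Equiv.Perm (Fin d) := Equiv.ofBijective _ (Finite.injective_iff_bijective.mp hinj)
    have hσ : (fun i : Fin d => Fin.append a b (Fin.cast hdn i)) = σ := rfl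
    have hid : gammaProd Γup id
        = ((Equiv.Perm.sign σ : ℤ) : ℂ) • (gammaProd Γup a * gammaProd Γup b) := by
      rw [← gammaProd_append Γup hdn, hσ]
      have := gammaProd_comp_perm hac' id Function.injective_id σ
      rw [Function.id_comp] at this
      rw [this, smul_smul, hsign, one_smul]
    have hprod : (∏ i, η (a i)) * ∏ i, η (b i) = (-1 : ℂ) ^ nt := by
      have h1 : ∏ x, η x = ∏ i, η (Fin.append a b i) :=
        (Equiv.prod_comp σ η).symm.trans
          (Equiv.prod_comp (finCongr hdn) fun i => η (Fin.append a b i))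
      rw [hnt, ← prod_eq_neg_one_pow_card hη, h1, Fin.prod_univ_add]
      simp
    rw [hσ, levi_perm, gammaAnti_of_injective hac b hb, hid, mul_smul_comm, ← mul_assoc,
      gammaProd_mul_self hac' hsq' a ha, gammaProd_smul hΓup b, smul_mul_assoc, one_mul,
      smul_smul, smul_smul, smul_smul, ← hprod]
    congr 1
    linear_combination (-((Equiv.Perm.sign σ : ℤ) : ℂ) * (∏ i, η (a i)) * ∏ i, η (b i)) * hone
  rw [Finset.sum_congr rfl fun b _ => hterm b, ← Finset.sum_filter, Finset.sum_const,
    card_filter_injective_append hdn a ha, gammaAnti_of_injective hac' a ha, hchir,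
    mul_smul_comm, hphase, ← Nat.cast_smul_eq_nsmul ℂ, smul_smul, smul_smul]
  congr 1
  rw [inv_mul_cancel_right₀ (hfac _), mul_assoc _ _ ((-1 : ℂ) ^ (n * (n - 1) / 2)),
    hone, mul_one]
end

section
/- Let 1 ≤ n ≤ 9 and let G be an alternating n-tensor on Minkowski ℝ^{10}. Then for all p, q ∈ Fin 10, the two-index square of its Hodge dual satisfies |⋆G|²_{pq} = −η_{pq} · |G|² + |G|²_{pq}. (This is the identity |G_{(10−n)}|²_{pq} = −|G_{(n)}|² η_{pq} + |G_{(n)}|²_{pq} of Appendix C, valid for all n = 1, …, 9.) -/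
open scoped BigOperators

/-- The flat Minkowski metric `η = diag(−1,+1,…,+1)` on `ℝ^{10}` (matrix entries);
indices are raised with `η`, whose inverse has the same entries. -/
noncomputable def etaMink : Fin 10 → Fin 10 → ℝ :=
  fun p q => if p = q then (if p = 0 then -1 else 1) else 0

/-- The real Levi-Civita symbol on ten indices, with `ε_{01…9} = +1`. -/
noncomputable def leviR (μ : Fin 10 → Fin 10) : ℝ :=
  ∑ π : Equiv.Perm (Fin 10), if μ = ⇑π then (((Equiv.Perm.sign π : ℤ)) : ℝ) else 0

/-- Concatenation `(κ₁,…,κₙ,ν₁,…,ν_{10−n})` of index strings, as a map `Fin 10 → Fin 10`. -/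
def catFn (n : ℕ) (κ : Fin n → Fin 10) (ν : Fin (10 - n) → Fin 10) : Fin 10 → Fin 10 :=
  fun j => if h : (j : ℕ) < n then κ ⟨j, h⟩
    else if h2 : (j : ℕ) - n < 10 - n then ν ⟨(j : ℕ) - n, h2⟩ else j

/-- The Hodge dual of an alternating `n`-tensor on Minkowski `ℝ^{10}`. -/
noncomputable def hodge (n : ℕ) (G : (Fin n → Fin 10) → ℝ)
    (ν : Fin (10 - n) → Fin 10) : ℝ :=
  (n.factorial : ℝ)⁻¹ * ∑ μ : Fin n → Fin 10, ∑ κ : Fin n → Fin 10,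
    G μ * (∏ i, etaMink (μ i) (κ i)) * leviR (catFn n κ ν)

/-- The index string `(p, μ₂, …, μ_m)` obtained by prepending `p` to `μ`. -/
def withHead {m : ℕ} (p : Fin 10) (μ : Fin (m - 1) → Fin 10) : Fin m → Fin 10 :=
  fun i => if h : (i : ℕ) = 0 then p else μ ⟨(i : ℕ) - 1, by omega⟩

/-- `|G|² := (1/m!) Σ G_{μ₁…μ_m} G_{ν₁…ν_m} η^{μ₁ν₁}⋯η^{μ_mν_m}`. -/
noncomputable def normSq (m : ℕ) (G : (Fin m → Fin 10) → ℝ) : ℝ :=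
  (m.factorial : ℝ)⁻¹ * ∑ μ : Fin m → Fin 10, ∑ ν : Fin m → Fin 10,
    G μ * G ν * ∏ i, etaMink (μ i) (ν i)

/-- `|G|²_{pq} := (1/(m−1)!) Σ G_{p μ₂…μ_m} G_{q ν₂…ν_m} η^{μ₂ν₂}⋯η^{μ_mν_m}`. -/
noncomputable def sq2 (m : ℕ) (G : (Fin m → Fin 10) → ℝ) (p q : Fin 10) : ℝ :=
  ((m - 1).factorial : ℝ)⁻¹ * ∑ μ : Fin (m - 1) → Fin 10, ∑ ν : Fin (m - 1) → Fin 10,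
    G (withHead p μ) * G (withHead q ν) * ∏ i, etaMink (μ i) (ν i)

open Equiv in
/-- A family of `π ∘ e` over all permutations `π` meets every injective tuple equally often. -/
theorem sum_perm_comp {α ι : Type*} [Fintype α] [DecidableEq α] [Fintype ι] [DecidableEq ι]
    (e : ι → α) (he : e.Injective) (f : (ι → α) → ℝ)
    (hf : ∀ μ, ¬ μ.Injective → f μ = 0) :
    ∑ π : Perm α, f (π ∘ e) = ((Fintype.card α - Fintype.card ι).factorial : ℝ) * ∑ μ, f μ := by
  classical
  have hfib : ∀ μ : ι → α, μ.Injective →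
      ((Finset.univ : Finset (Perm α)).filter fun π : Perm α => π ∘ e = μ).card
        = ((Finset.univ : Finset (Perm α)).filter fun π : Perm α => π ∘ e = e).card := by
    intro μ hμ
    obtain ⟨σ, hσ⟩ : ∃ σ : Perm α, σ ∘ e = μ := by
      let g : {x // x ∈ Set.range e} ≃ {x // x ∈ Set.range μ} :=
        (Equiv.ofInjective e he).symm.trans (Equiv.ofInjective μ hμ)
      refine ⟨g.extendSubtype, funext fun i => ?_⟩
      rw [Function.comp_apply, Equiv.extendSubtype_apply_of_mem _ _ ⟨i, rfl⟩]
      simp only [g, Equiv.trans_apply]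
      have : (⟨e i, i, rfl⟩ : {x // x ∈ Set.range e}) = Equiv.ofInjective e he i := rfl
      rw [this, Equiv.symm_apply_apply]
      rfl
    refine Finset.card_equiv (Equiv.mulLeft σ⁻¹) fun π => ?_
    simp only [Finset.mem_filter, Finset.mem_univ, true_and, Equiv.coe_mulLeft, Perm.coe_mul,
      ← hσ, funext_iff, Function.comp_apply, Perm.inv_eq_iff_eq]
  have hcard : ((Finset.univ : Finset (Perm α)).filter fun π : Perm α => π ∘ e = e).card
      = (Fintype.card α - Fintype.card ι).factorial := by
    have htot : ∑ μ : ι → α,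
        ((Finset.univ : Finset (Perm α)).filter fun π : Perm α => π ∘ e = μ).card
          = (Fintype.card α).factorial := by
      rw [← Fintype.card_perm, ← Finset.card_univ]
      exact (Finset.card_eq_sum_card_fiberwise fun _ _ => Finset.mem_coe.2 (Finset.mem_univ _)).symm
    have hle : Fintype.card ι ≤ Fintype.card α := Fintype.card_le_of_injective e he
    have hinj : ((Finset.univ : Finset (ι → α)).filter Function.Injective).card
        = (Fintype.card α).descFactorial (Fintype.card ι) := by
      rw [← Fintype.card_embedding_eq, ← Fintype.card_subtype]
      exact Fintype.card_congr (Equiv.subtypeInjectiveEquivEmbedding ι α)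
    rw [← Finset.sum_filter_add_sum_filter_not _ Function.Injective,
      Finset.sum_congr rfl fun μ hμ => hfib μ (Finset.mem_filter.1 hμ).2, Finset.sum_const,
      Finset.sum_eq_zero (s := Finset.univ.filter fun μ : ι → α => ¬ μ.Injective), add_zero,
      smul_eq_mul, hinj, ← Nat.factorial_mul_descFactorial hle, mul_comm] at htot
    · exact Nat.eq_of_mul_eq_mul_right (Nat.descFactorial_pos.2 hle) htot
    · intro μ hμ
      rw [Finset.card_eq_zero, Finset.filter_eq_empty_iff]
      rintro π - rfl
      exact (Finset.mem_filter.1 hμ).2 (π.injective.comp he)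
  rw [← Finset.sum_fiberwise (s := Finset.univ) (g := fun π : Perm α => π ∘ e), Finset.mul_sum]
  refine Finset.sum_congr rfl fun μ _ => ?_
  rw [Finset.sum_congr rfl fun π hπ => congrArg f (Finset.mem_filter.1 hπ).2, Finset.sum_const,
    nsmul_eq_mul]
  by_cases hμ : μ.Injective
  · rw [hfib μ hμ, hcard]
  · rw [hf μ hμ, mul_zero, mul_zero]

open Equiv in
/-- `sum_perm_comp` with some of the entries of the tuple prescribed. -/
theorem sum_perm_comp_of_eq {α ι κ : Type*} [Fintype α] [DecidableEq α] [Fintype ι]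
    [DecidableEq ι] [Fintype κ] [DecidableEq κ]
    (e : ι → α) (d : κ → α) (hed : (Sum.elim e d).Injective) (c : κ → α) (f : (ι → α) → ℝ)
    (hf : ∀ μ, ¬ (Sum.elim μ c).Injective → f μ = 0) :
    ∑ π : Perm α, (if π ∘ d = c then f (π ∘ e) else 0)
      = ((Fintype.card α - (Fintype.card ι + Fintype.card κ)).factorial : ℝ) * ∑ μ, f μ := by
  have h := sum_perm_comp (Sum.elim e d) hed
    (fun μ => if μ ∘ Sum.inr = c then f (μ ∘ Sum.inl) else 0) (fun μ hμ => by
      split_ifs with hc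
      · refine hf _ ?_
        rwa [← hc, Sum.elim_comp_inl_inr]
      · rfl)
  rw [Fintype.card_sum] at h
  rw [← (Equiv.sumArrowEquivProdArrow ι κ α).symm.sum_comp, Fintype.sum_prod_type] at h
  have hsum : ∀ μ : ι → α, ∑ ν : κ → α,
      (if (Equiv.sumArrowEquivProdArrow ι κ α).symm (μ, ν) ∘ Sum.inr = c then
        f ((Equiv.sumArrowEquivProdArrow ι κ α).symm (μ, ν) ∘ Sum.inl) else 0) = f μ := fun μ => 
    (Finset.sum_eq_single c (fun ν _ hν => if_neg hν) (by simp)).trans (if_pos rfl)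
  simp only [hsum] at h
  exact h

/-- The diagonal entries of the Minkowski metric. -/
noncomputable def etaDiag (x : Fin 10) : ℝ := if x = 0 then -1 else 1

theorem etaDiag_mul_self (x : Fin 10) : etaDiag x * etaDiag x = 1 := by
  unfold etaDiag; split_ifs <;> norm_num

theorem prod_etaDiag_perm (π : Equiv.Perm (Fin 10)) : ∏ i, etaDiag (π i) = -1 := by
  rw [Equiv.prod_comp π etaDiag]
  simp [etaDiag]

theorem prod_etaMink {ι : Type*} [Fintype ι] [DecidableEq ι] (μ κ : ι → Fin 10) :
    ∏ i, etaMink (μ i) (κ i) = if μ = κ then ∏ i, etaDiag (μ i) else 0 := by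
  have : ∀ i, etaMink (μ i) (κ i) = if μ i = κ i then etaDiag (μ i) else 0 := fun i => rfl
  simp only [this, Finset.prod_ite_zero, Finset.mem_univ, true_imp_iff, funext_iff]

/-- Antisymmetry of a tensor under exchange of any two of its arguments. -/
def IsAlternatingTensor {ι : Type*} [DecidableEq ι] (F : (ι → Fin 10) → ℝ) : Prop :=
  ∀ (a : ι → Fin 10) (i j : ι), i ≠ j → F (a ∘ Equiv.swap i j) = -F a

theorem IsAlternatingTensor.eq_zero {ι : Type*} [DecidableEq ι] {F : (ι → Fin 10) → ℝ}
    (hF : IsAlternatingTensor F) (a : ι → Fin 10) (ha : ¬ a.Injective) : F a = 0 := by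
  simp only [Function.Injective, not_forall] at ha
  obtain ⟨i, j, hij, hne⟩ := ha
  have h := hF a i j hne
  rw [Equiv.comp_swap_eq_update, hij, Function.update_eq_self, ← hij, Function.update_eq_self] at h
  linarith

theorem leviR_perm (π : Equiv.Perm (Fin 10)) : leviR π = ((Equiv.Perm.sign π : ℤ) : ℝ) := by
  simp [leviR, DFunLike.coe_fn_eq]

theorem leviR_alternating : IsAlternatingTensor leviR := by
  intro a i j hij
  simp only [leviR]
  rw [← Fintype.sum_equiv (Equiv.mulRight (Equiv.swap i j)) _ _ fun _ => rfl, ← Finset.sum_neg_distrib]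
  refine Finset.sum_congr rfl fun π _ => ?_
  have : a ∘ Equiv.swap i j = ⇑(π * Equiv.swap i j) ↔ a = π := by
    rw [Equiv.Perm.coe_mul]
    exact (Equiv.swap i j).surjective.injective_comp_right.eq_iff
  simp only [Equiv.coe_mulRight, this, Equiv.Perm.sign_mul, Equiv.Perm.sign_swap hij]
  split_ifs <;> simp

theorem sq2_eq (m : ℕ) (F : (Fin m → Fin 10) → ℝ) (p q : Fin 10) :
    sq2 m F p q = ((m - 1).factorial : ℝ)⁻¹ * ∑ μ : Fin (m - 1) → Fin 10,
      F (withHead p μ) * F (withHead q μ) * ∏ i, etaDiag (μ i) := by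
  simp [sq2, prod_etaMink]

theorem normSq_eq (m : ℕ) (F : (Fin m → Fin 10) → ℝ) :
    normSq m F = (m.factorial : ℝ)⁻¹ * ∑ μ : Fin m → Fin 10,
      F μ * F μ * ∏ i, etaDiag (μ i) := by
  simp [normSq, prod_etaMink]

theorem hodge_eq (n : ℕ) (G : (Fin n → Fin 10) → ℝ) (ν : Fin (10 - n) → Fin 10) :
    hodge n G ν = (n.factorial : ℝ)⁻¹ * ∑ μ : Fin n → Fin 10,
      G μ * (∏ i, etaDiag (μ i)) * leviR (catFn n μ ν) := by
  simp [hodge, prod_etaMink]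

/-- The first `n` positions among ten. -/
def headPos (n : ℕ) (hn : n ≤ 9) (i : Fin n) : Fin 10 := ⟨i, by omega⟩

/-- The last `10 - n` positions among ten. -/
def tailPos (n : ℕ) (i : Fin (10 - n)) : Fin 10 := ⟨n + i, by omega⟩

/-- The position in `Fin m` of an entry that follows the leading one. -/
def succPos {m : ℕ} (i : Fin (m - 1)) : Fin m := ⟨i + 1, by omega⟩

theorem headPos_injective (n : ℕ) (hn : n ≤ 9) : (headPos n hn).Injective := fun i j h => by
  simpa [headPos, Fin.ext_iff] using h

theorem tailPos_injective (n : ℕ) : (tailPos n).Injective := fun i j h => by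
  simpa [tailPos, Fin.ext_iff] using h

theorem succPos_injective {m : ℕ} : (succPos (m := m)).Injective := fun i j h => by
  simpa [succPos, Fin.ext_iff] using h

theorem catFn_comp (n : ℕ) (hn : n ≤ 9) (a : Fin 10 → Fin 10) :
    catFn n (a ∘ headPos n hn) (a ∘ tailPos n) = a := by
  funext j
  unfold catFn
  split_ifs with h h2
  · rfl
  · exact congrArg a (Fin.ext (by simp only [tailPos]; omega))
  · omega

theorem catFn_headPos (n : ℕ) (hn : n ≤ 9) (κ : Fin n → Fin 10) (ν : Fin (10 - n) → Fin 10) :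
    catFn n κ ν ∘ headPos n hn = κ := by
  funext j
  simp [catFn, headPos]

theorem catFn_tailPos (n : ℕ) (κ : Fin n → Fin 10) (ν : Fin (10 - n) → Fin 10) :
    catFn n κ ν ∘ tailPos n = ν := by
  funext j
  simp [catFn, tailPos]

theorem comp_swap_comp {ι α β : Type*} [DecidableEq ι] [DecidableEq α] (a : α → β) {e : ι → α}
    (he : e.Injective) (i j : ι) :
    (a ∘ Equiv.swap (e i) (e j)) ∘ e = (a ∘ e) ∘ Equiv.swap i j := by
  funext k
  simp [he.swap_apply]

theorem headPos_ne_tailPos (n : ℕ) (hn : n ≤ 9) (i : Fin n) (j : Fin (10 - n)) :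
    headPos n hn i ≠ tailPos n j := by
  simp only [headPos, tailPos, ne_eq, Fin.mk.injEq]
  omega

theorem catFn_comp_swap_left (n : ℕ) (hn : n ≤ 9) (κ : Fin n → Fin 10)
    (ν : Fin (10 - n) → Fin 10) (i j : Fin n) :
    catFn n (κ ∘ Equiv.swap i j) ν
      = catFn n κ ν ∘ Equiv.swap (headPos n hn i) (headPos n hn j) := by
  rw [← catFn_comp n hn (catFn n κ ν ∘ _), comp_swap_comp _ (headPos_injective n hn),
    catFn_headPos]
  congr 1
  conv_lhs => rw [← catFn_tailPos n κ ν]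
  funext k
  simp [Equiv.swap_apply_of_ne_of_ne, (headPos_ne_tailPos n hn _ k).symm]

theorem catFn_comp_swap_right (n : ℕ) (hn : n ≤ 9) (κ : Fin n → Fin 10)
    (ν : Fin (10 - n) → Fin 10) (i j : Fin (10 - n)) :
    catFn n κ (ν ∘ Equiv.swap i j)
      = catFn n κ ν ∘ Equiv.swap (tailPos n i) (tailPos n j) := by
  rw [← catFn_comp n hn (catFn n κ ν ∘ _), comp_swap_comp _ (tailPos_injective n),
    catFn_tailPos]
  congr 1
  conv_lhs => rw [← catFn_headPos n hn κ ν]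
  funext k
  simp [Equiv.swap_apply_of_ne_of_ne, headPos_ne_tailPos n hn k _]

theorem hodge_alternating (n : ℕ) (hn : n ≤ 9) (G : (Fin n → Fin 10) → ℝ) :
    IsAlternatingTensor (hodge n G) := by
  intro a i j hij
  simp only [hodge_eq, catFn_comp_swap_right n hn,
    leviR_alternating _ _ _ ((tailPos_injective n).ne hij)]
  simp

theorem hodge_perm (n : ℕ) (hn : n ≤ 9) (G : (Fin n → Fin 10) → ℝ) (hG : IsAlternatingTensor G)
    (π : Equiv.Perm (Fin 10)) :
    hodge n G (π ∘ tailPos n) = G (π ∘ headPos n hn) * (∏ i, etaDiag (π (headPos n hn i))) *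
      ((Equiv.Perm.sign π : ℤ) : ℝ) := by
  set f : (Fin n → Fin 10) → ℝ :=
    fun μ => G μ * (∏ i, etaDiag (μ i)) * leviR (catFn n μ (π ∘ tailPos n)) with hf
  have hsymm : ∀ (σ : Equiv.Perm (Fin n)) (a : Fin n → Fin 10), f (a ∘ σ) = f a := by
    intro σ
    induction σ using Equiv.Perm.swap_induction_on with
    | one => intro a; rfl
    | swap_mul τ i j hij ih =>
      intro a
      rw [Equiv.Perm.coe_mul, ← Function.comp_assoc, ih]
      simp only [hf, catFn_comp_swap_left n hn,
        leviR_alternating _ _ _ ((headPos_injective n hn).ne hij), hG a i j hij,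
        Function.comp_apply]
      rw [Equiv.prod_comp (Equiv.swap i j) fun k => etaDiag (a k)]
      ring
  have hsum : ∑ μ, f μ = ∑ σ : Equiv.Perm (Fin n), f ((π ∘ headPos n hn) ∘ σ) := by
    symm
    refine Finset.sum_of_injOn (fun σ : Equiv.Perm (Fin n) => (π ∘ headPos n hn) ∘ σ) ?_
      (fun _ _ => Finset.mem_coe.2 (Finset.mem_univ _)) ?_ fun _ _ => rfl
    · intro σ _ τ _ h
      exact Equiv.coe_fn_injective
        ((π.injective.comp (headPos_injective n hn)).comp_left h)
    · intro μ _ hμ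
      by_contra hne
      have hinj : (catFn n μ (π ∘ tailPos n)).Injective := by
        by_contra h
        exact hne (by simp only [hf, leviR_alternating.eq_zero _ h, mul_zero])
      have hlt : ∀ i, (π.symm (μ i) : ℕ) < n := by
        intro i
        by_contra h
        refine headPos_ne_tailPos n hn i ⟨π.symm (μ i) - n, by omega⟩ (hinj ?_)
        rw [← Function.comp_apply (f := catFn _ _ _), catFn_headPos,
          ← Function.comp_apply (f := catFn _ _ _) (g := tailPos n), catFn_tailPos,
          Function.comp_apply, ← Equiv.symm_apply_eq]
        exact Fin.ext (by simp only [tailPos]; omega)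
      have hμinj : μ.Injective := by
        rw [← catFn_headPos n hn μ (π ∘ tailPos n)]
        exact hinj.comp (headPos_injective n hn)
      have hσ : (fun i => (⟨π.symm (μ i), hlt i⟩ : Fin n)).Injective := fun i j h =>
        hμinj (π.symm.injective (Fin.ext (Fin.mk.inj h)))
      refine hμ ⟨Equiv.ofBijective _ (Finite.injective_iff_bijective.1 hσ),
        Finset.mem_coe.2 (Finset.mem_univ _), funext fun i => ?_⟩
      simp [headPos]
  rw [hodge_eq, hsum, Finset.sum_congr rfl fun σ _ => hsymm σ _, Finset.sum_const,
    Finset.card_univ, Fintype.card_perm, Fintype.card_fin, nsmul_eq_mul,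
    inv_mul_cancel_left₀ (by positivity)]
  simp only [hf, catFn_comp, leviR_perm, Function.comp_apply]

theorem withHead_comp {α : Type*} {m : ℕ} (hm : 0 < m) (a : α → Fin 10) (e : Fin m → α) :
    withHead (a (e ⟨0, hm⟩)) (a ∘ e ∘ succPos) = a ∘ e := by
  funext i
  unfold withHead
  split_ifs with h
  · exact congrArg (fun x => a (e x)) (Fin.ext h.symm)
  · exact congrArg (fun x => a (e x)) (Fin.ext (by simp only [succPos]; omega))

theorem withHead_injective {m : ℕ} (p : Fin 10) (ν : Fin (m - 1) → Fin 10)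
    (h : (withHead (m := m) p ν).Injective) : ν.Injective ∧ ∀ j, ν j ≠ p := by
  have hs : ∀ j, withHead (m := m) p ν (succPos j) = ν j := fun j => by simp [withHead, succPos]
  refine ⟨fun i j hij => succPos_injective (h ((hs i).trans (hij.trans (hs j).symm))),
    fun j hj => ?_⟩
  have h0 : withHead (m := m) p ν ⟨0, by have := j.isLt; omega⟩ = p := by simp [withHead]
  simpa [succPos] using h ((hs j).trans (hj.trans h0.symm))

theorem prod_etaDiag_succPos {m : ℕ} (hm : 0 < m) (μ : Fin m → Fin 10) :
    ∏ i, etaDiag (μ i) = etaDiag (μ ⟨0, hm⟩) * ∏ i, etaDiag (μ (succPos i)) := by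
  obtain ⟨k, rfl⟩ : ∃ k, m = k + 1 := ⟨m - 1, by omega⟩
  exact Fin.prod_univ_succ _

theorem bijective_head_tail (n : ℕ) (hn : n ≤ 9) :
    (Sum.elim (headPos n hn) (tailPos n)).Bijective := by
  rw [Fintype.bijective_iff_injective_and_card]
  refine ⟨(headPos_injective n hn).sumElim (tailPos_injective n) (headPos_ne_tailPos n hn), ?_⟩
  simp only [Fintype.card_sum, Fintype.card_fin]
  omega

theorem prod_etaDiag_head_tail (n : ℕ) (hn : n ≤ 9) (π : Equiv.Perm (Fin 10)) :
    (∏ i, etaDiag (π (headPos n hn i))) * ∏ i, etaDiag (π (tailPos n i)) = -1 := by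
  rw [← prod_etaDiag_perm π, ← (bijective_head_tail n hn).prod_comp fun i => etaDiag (π i),
    Fintype.prod_sum_type]
  rfl

/-- A symmetric function of the head entries of `π`, summed over all `π`, splits according to
whether a given value `p` is taken on the head or on the tail. -/
theorem sum_perm_head_split (n : ℕ) (hn1 : 1 ≤ n) (hn : n ≤ 9) (g : (Fin n → Fin 10) → ℝ)
    (hg : ∀ a i j, g (a ∘ Equiv.swap i j) = g a) (p : Fin 10) :
    ∑ π : Equiv.Perm (Fin 10), g (π ∘ headPos n hn)
      = n * (∑ π : Equiv.Perm (Fin 10),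
          if π (headPos n hn ⟨0, hn1⟩) = p then g (π ∘ headPos n hn) else 0)
        + ((10 - n : ℕ) : ℝ) * ∑ π : Equiv.Perm (Fin 10),
          if π (tailPos n ⟨0, by omega⟩) = p then g (π ∘ headPos n hn) else 0 := by
  set P : Fin 10 → ℝ := fun j =>
    ∑ π : Equiv.Perm (Fin 10), if π j = p then g (π ∘ headPos n hn) else 0 with hP
  have hswap : ∀ x y, (∀ a : Fin 10 → Fin 10,
      g ((a ∘ Equiv.swap x y) ∘ headPos n hn) = g (a ∘ headPos n hn)) → P x = P y := by
    intro x y h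
    simp only [hP]
    rw [← Fintype.sum_equiv (Equiv.mulRight (Equiv.swap x y)) _ _ fun _ => rfl]
    simp only [Equiv.coe_mulRight, Equiv.Perm.coe_mul, h, Function.comp_apply,
      Equiv.swap_apply_left]
  have hhead : ∀ i, P (headPos n hn i) = P (headPos n hn ⟨0, hn1⟩) := fun i =>
    hswap _ _ fun a => by rw [comp_swap_comp _ (headPos_injective n hn), hg]
  have htail : ∀ i, P (tailPos n i) = P (tailPos n ⟨0, by omega⟩) := fun i =>
    hswap _ _ fun a => by
      congr 1
      funext k
      simp [Equiv.swap_apply_of_ne_of_ne, headPos_ne_tailPos n hn k _]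
  have htotal : ∑ π : Equiv.Perm (Fin 10), g (π ∘ headPos n hn) = ∑ j, P j := by
    simp only [hP]
    rw [Finset.sum_comm]
    refine Finset.sum_congr rfl fun π _ => ?_
    simp [← Equiv.eq_symm_apply]
  rw [htotal, ← (bijective_head_tail n hn).sum_comp, Fintype.sum_sum_type]
  simp only [Sum.elim_inl, Sum.elim_inr, hhead, htail, Finset.sum_const, Finset.card_univ,
    Fintype.card_fin, nsmul_eq_mul]
  rfl

theorem sq2_self {m : ℕ} (hm : 0 < m) {F : (Fin m → Fin 10) → ℝ} (hF : IsAlternatingTensor F)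
    (e : Fin m → Fin 10) (he : e.Injective) (p : Fin 10) :
    ((m - 1).factorial : ℝ) * ((10 - m).factorial : ℝ) * sq2 m F p p
      = etaDiag p * ∑ π : Equiv.Perm (Fin 10), if π (e ⟨0, hm⟩) = p then
        F (π ∘ e) * F (π ∘ e) * ∏ i, etaDiag (π (e i)) else 0 := by
  have h := sum_perm_comp_of_eq (e ∘ succPos) (fun _ : Unit => e ⟨0, hm⟩)
    ((he.comp succPos_injective).sumElim (fun _ _ _ => rfl)
      fun i _ h => by simpa [succPos] using he h)
    (fun _ => p) (fun μ => F (withHead p μ) * F (withHead p μ) * ∏ i, etaDiag (μ i)) (by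
      intro μ hμ
      by_contra hne
      obtain ⟨h1, h2⟩ := withHead_injective p μ (by
        by_contra hni
        exact hne (by simp [hF.eq_zero _ hni]))
      exact hμ (h1.sumElim (fun _ _ _ => rfl) fun i _ => h2 i))
  simp only [Fintype.card_fin, Fintype.card_unit, Nat.sub_add_cancel hm] at h
  rw [sq2_eq, mul_comm (_ : ℝ) ((10 - m).factorial : ℝ), mul_assoc,
    mul_inv_cancel_left₀ (by positivity), ← h, Finset.mul_sum]
  refine Finset.sum_congr rfl fun π _ => ?_
  have hiff : (π ∘ (fun _ : Unit => e ⟨0, hm⟩) = fun _ => p) ↔ π (e ⟨0, hm⟩) = p := by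
    simp [funext_iff]
  simp only [hiff]
  split_ifs with hp
  · rw [← hp, withHead_comp hm π e, prod_etaDiag_succPos hm fun i => π (e i)]
    simp only [Function.comp_apply]
    linear_combination (-F (π ∘ e) * F (π ∘ e) * ∏ i, etaDiag (π (e (succPos i)))) *
      etaDiag_mul_self (π (e ⟨0, hm⟩))
  · rw [mul_zero]

theorem sq2_of_ne {m : ℕ} (hm : 0 < m) {F : (Fin m → Fin 10) → ℝ} (hF : IsAlternatingTensor F)
    (e : Fin (m - 1) → Fin 10) (he : e.Injective) (x y : Fin 10) (hxy : x ≠ y)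
    (hx : ∀ i, e i ≠ x) (hy : ∀ i, e i ≠ y) (p q : Fin 10) (hpq : p ≠ q) :
    ((m - 1).factorial : ℝ) * ((9 - m).factorial : ℝ) * sq2 m F p q
      = ∑ π : Equiv.Perm (Fin 10), if π x = p ∧ π y = q then
        F (withHead p (π ∘ e)) * F (withHead q (π ∘ e)) * ∏ i, etaDiag (π (e i)) else 0 := by
  have hinj : ∀ {a b : Fin 10}, a ≠ b → (![a, b]).Injective := by
    intro a b hab i j
    fin_cases i <;> fin_cases j <;> simp [hab, hab.symm]
  have h := sum_perm_comp_of_eq e ![x, y] (he.sumElim (hinj hxy) fun i j => by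
      fin_cases j; exacts [hx i, hy i])
    ![p, q] (fun μ => F (withHead p μ) * F (withHead q μ) * ∏ i, etaDiag (μ i)) (by
      intro μ hμ
      by_contra hne
      obtain ⟨h1, h2⟩ := withHead_injective p μ (by
        by_contra hni
        exact hne (by simp [hF.eq_zero _ hni]))
      obtain ⟨-, h3⟩ := withHead_injective q μ (by
        by_contra hni
        exact hne (by simp [hF.eq_zero _ hni]))
      exact hμ (h1.sumElim (hinj hpq) fun i j => by fin_cases j; exacts [h2 i, h3 i]))
  have hcard : 10 - (m - 1 + 2) = 9 - m := by omega
  simp only [Fintype.card_fin, hcard] at h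
  rw [sq2_eq, mul_comm (_ : ℝ) ((9 - m).factorial : ℝ), mul_assoc,
    mul_inv_cancel_left₀ (by positivity), ← h]
  refine Finset.sum_congr rfl fun π _ => ?_
  have hiff : (π ∘ ![x, y] = ![p, q]) ↔ π x = p ∧ π y = q := by
    simp [funext_iff, Fin.forall_fin_two]
  simp only [hiff, Function.comp_apply]

theorem normSq_perm (n : ℕ) (hn : n ≤ 9) {G : (Fin n → Fin 10) → ℝ}
    (hG : IsAlternatingTensor G) :
    (n.factorial : ℝ) * ((10 - n).factorial : ℝ) * normSq n G
      = ∑ π : Equiv.Perm (Fin 10), G (π ∘ headPos n hn) * G (π ∘ headPos n hn) *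
        ∏ i, etaDiag ((π ∘ headPos n hn) i) := by
  rw [sum_perm_comp (headPos n hn) (headPos_injective n hn)
    (fun μ => G μ * G μ * ∏ i, etaDiag (μ i)) fun μ hμ => by simp [hG.eq_zero μ hμ], normSq_eq]
  simp only [Fintype.card_fin]
  field_simp

theorem sq2_hodge_self (n : ℕ) (hn1 : 1 ≤ n) (hn9 : n ≤ 9) {G : (Fin n → Fin 10) → ℝ}
    (hG : IsAlternatingTensor G) (p : Fin 10) :
    sq2 (10 - n) (hodge n G) p p = -etaDiag p * normSq n G + sq2 n G p p := by
  have hL := sq2_self (by omega : 0 < 10 - n) (hodge_alternating n hn9 G) (tailPos n)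
    (tailPos_injective n) p
  have hS := sq2_self hn1 hG (headPos n hn9) (headPos_injective n hn9) p
  have hT := sum_perm_head_split n hn1 hn9 (fun μ => G μ * G μ * ∏ i, etaDiag (μ i))
    (fun a i j => by
      by_cases hij : i = j
      · subst hij; simp
      · simp only [hG a i j hij, Function.comp_apply]
        rw [Equiv.prod_comp (Equiv.swap i j) fun k => etaDiag (a k), neg_mul_neg]) p
  rw [← normSq_perm n hn9 hG] at hT
  have hterm : ∀ π : Equiv.Perm (Fin 10),
      hodge n G (π ∘ tailPos n) * hodge n G (π ∘ tailPos n) * ∏ i, etaDiag (π (tailPos n i))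
        = -(G (π ∘ headPos n hn9) * G (π ∘ headPos n hn9) *
            ∏ i, etaDiag ((π ∘ headPos n hn9) i)) := by
    intro π
    have hsign : ((Equiv.Perm.sign π : ℤ) : ℝ) * ((Equiv.Perm.sign π : ℤ) : ℝ) = 1 := by
      exact_mod_cast Int.units_coe_mul_self _
    have hprod := prod_etaDiag_head_tail n hn9 π
    rw [hodge_perm n hn9 G hG]
    simp only [Function.comp_apply]
    generalize (∏ i, etaDiag (π (headPos n hn9 i))) = u at *
    generalize (∏ i, etaDiag (π (tailPos n i))) = v at *
    generalize ((Equiv.Perm.sign π : ℤ) : ℝ) = σ at *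
    linear_combination (G (π ∘ headPos n hn9)) ^ 2 * (u * u * v * hsign + u * hprod)
  have hneg : (∑ π : Equiv.Perm (Fin 10), if π (tailPos n ⟨0, by omega⟩) = p then
      hodge n G (π ∘ tailPos n) * hodge n G (π ∘ tailPos n) * ∏ i, etaDiag (π (tailPos n i))
        else 0) = -∑ π : Equiv.Perm (Fin 10), if π (tailPos n ⟨0, by omega⟩) = p then
      G (π ∘ headPos n hn9) * G (π ∘ headPos n hn9) *
        ∏ i, etaDiag ((π ∘ headPos n hn9) i) else 0 := by
    rw [← Finset.sum_neg_distrib]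
    exact Finset.sum_congr rfl fun π _ => by rw [hterm]; split_ifs <;> simp
  rw [hneg] at hL
  have hfn : (n.factorial : ℝ) = n * ((n - 1).factorial : ℝ) := by
    exact_mod_cast (Nat.mul_factorial_pred (by omega)).symm
  have hfc : ((10 - n).factorial : ℝ) = ((10 - n : ℕ) : ℝ) * ((10 - n - 1).factorial : ℝ) := by
    exact_mod_cast (Nat.mul_factorial_pred (by omega)).symm
  have hsub : 10 - (10 - n) = n := by omega
  rw [hsub] at hL
  have hpos : (n.factorial : ℝ) * ((10 - n).factorial : ℝ) ≠ 0 := by positivity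
  refine mul_left_cancel₀ hpos ?_
  simp only [Function.comp_apply] at hT hL
  linear_combination ((10 - n : ℕ) : ℝ) * hL - n * hS + etaDiag p * hT +
    (n.factorial : ℝ) * sq2 (10 - n) (hodge n G) p p * hfc -
    ((10 - n).factorial : ℝ) * sq2 n G p p * hfn

theorem sq2_hodge_of_ne (n : ℕ) (hn1 : 1 ≤ n) (hn9 : n ≤ 9) {G : (Fin n → Fin 10) → ℝ}
    (hG : IsAlternatingTensor G) (p q : Fin 10) (hpq : p ≠ q) :
    sq2 (10 - n) (hodge n G) p q = sq2 n G p q := by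
  have hc : 0 < 10 - n := by omega
  set x := tailPos n ⟨0, hc⟩ with hx
  set y := headPos n hn9 ⟨0, hn1⟩ with hy
  have hxy : x ≠ y := (headPos_ne_tailPos n hn9 _ _).symm
  have htx : ∀ i : Fin (10 - n - 1), (tailPos n ∘ succPos) i ≠ x := fun i =>
    (tailPos_injective n).ne (by simp [succPos])
  have hty : ∀ i : Fin (10 - n - 1), (tailPos n ∘ succPos) i ≠ y := fun i =>
    (headPos_ne_tailPos n hn9 _ _).symm
  have hhx : ∀ i : Fin (n - 1), (headPos n hn9 ∘ succPos) i ≠ x := fun i =>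
    headPos_ne_tailPos n hn9 _ _
  have hhy : ∀ i : Fin (n - 1), (headPos n hn9 ∘ succPos) i ≠ y := fun i =>
    (headPos_injective n hn9).ne (by simp [succPos])
  have hL := sq2_of_ne hc (hodge_alternating n hn9 G) (tailPos n ∘ succPos)
    ((tailPos_injective n).comp succPos_injective) x y hxy htx hty p q hpq
  have hS := sq2_of_ne hn1 hG (headPos n hn9 ∘ succPos)
    ((headPos_injective n hn9).comp succPos_injective) x y hxy hhx hhy p q hpq
  have h1 : 10 - n - 1 = 9 - n := by omega
  have h2 : 9 - (10 - n) = n - 1 := by omega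
  have hpos : ((n - 1).factorial : ℝ) * ((9 - n).factorial : ℝ) ≠ 0 := by positivity
  refine mul_left_cancel₀ hpos ?_
  rw [hS, mul_comm ((n - 1).factorial : ℝ)]
  rw [h2] at hL
  have h3 : ((9 - n).factorial : ℝ) = ((10 - n - 1).factorial : ℝ) := by rw [h1]
  rw [h3, hL]
  refine Finset.sum_congr rfl fun π _ => ?_
  split_ifs with h
  swap
  · rfl
  obtain ⟨hp, hq⟩ := h
  set ρ : Equiv.Perm (Fin 10) := π * Equiv.swap x y with hρ
  have hρx : ρ x = q := by simp [hρ, hq]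
  have hρy : ρ y = p := by simp [hρ, hp]
  have hρt : ρ ∘ tailPos n ∘ succPos = π ∘ tailPos n ∘ succPos := by
    funext i
    exact congrArg π (Equiv.swap_apply_of_ne_of_ne (htx i) (hty i))
  have hρh : ρ ∘ headPos n hn9 ∘ succPos = π ∘ headPos n hn9 ∘ succPos := by
    funext i
    exact congrArg π (Equiv.swap_apply_of_ne_of_ne (hhx i) (hhy i))
  have e1 := withHead_comp hc π (tailPos n)
  have e2 := withHead_comp hc ρ (tailPos n)
  have e3 := withHead_comp hn1 π (headPos n hn9)
  have e4 := withHead_comp hn1 ρ (headPos n hn9)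
  rw [← hx, hp] at e1
  rw [← hx, hρx, hρt] at e2
  rw [← hy, hq] at e3
  rw [← hy, hρy, hρh] at e4
  have hsign : ((Equiv.Perm.sign ρ : ℤ) : ℝ) = -((Equiv.Perm.sign π : ℤ) : ℝ) := by
    simp [hρ, Equiv.Perm.sign_swap hxy]
  have hsq : ((Equiv.Perm.sign π : ℤ) : ℝ) * ((Equiv.Perm.sign π : ℤ) : ℝ) = 1 := by
    exact_mod_cast Int.units_coe_mul_self _
  have hprod := prod_etaDiag_head_tail n hn9 π
  rw [e1, e2, e3, e4, hodge_perm n hn9 G hG, hodge_perm n hn9 G hG, hsign,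
    prod_etaDiag_succPos hn1 fun i => ρ (headPos n hn9 i),
    prod_etaDiag_succPos hn1 fun i => π (headPos n hn9 i), ← hy, hq, hρy]
  rw [prod_etaDiag_succPos hn1 fun i => π (headPos n hn9 i),
    prod_etaDiag_succPos hc fun i => π (tailPos n i), ← hy, ← hx, hp, hq] at hprod
  have hA : ∏ i : Fin (n - 1), etaDiag (ρ (headPos n hn9 (succPos i)))
      = ∏ i : Fin (n - 1), etaDiag (π (headPos n hn9 (succPos i))) :=
    Finset.prod_congr rfl fun i _ => congrArg etaDiag (congrFun hρh i)
  rw [hA]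
  simp only [Function.comp_apply]
  generalize (∏ i : Fin (n - 1), etaDiag (π (headPos n hn9 (succPos i)))) = u at *
  generalize (∏ i : Fin (10 - n - 1), etaDiag (π (tailPos n (succPos i)))) = v at *
  generalize ((Equiv.Perm.sign π : ℤ) : ℝ) = σ at *
  linear_combination -(G (π ∘ headPos n hn9) * G (ρ ∘ headPos n hn9) * u) *
    (etaDiag q * u * etaDiag p * v * hsq + hprod)

/-- Appendix C: `|G_{(10−n)}|²_{pq} = −|G_{(n)}|² η_{pq} + |G_{(n)}|²_{pq}`.
For `1 ≤ n ≤ 9` and an alternating `n`-tensor `G` on Minkowski `ℝ^{10}`, the two-index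
square of its Hodge dual satisfies `|⋆G|²_{pq} = −η_{pq} |G|² + |G|²_{pq}`. -/
theorem stmt6 (n : ℕ) (hn1 : 1 ≤ n) (hn9 : n ≤ 9)
    (G : (Fin n → Fin 10) → ℝ)
    (hG : ∀ (a : Fin n → Fin 10) (i j : Fin n), i ≠ j →
      G (a ∘ Equiv.swap i j) = - G a)
    (p q : Fin 10) :
    sq2 (10 - n) (hodge n G) p q = - etaMink p q * normSq n G + sq2 n G p q := by
  by_cases hpq : p = q
  · subst hpq
    have hη : etaMink p p = etaDiag p := by simp [etaMink, etaDiag]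
    rw [hη]
    exact sq2_hodge_self n hn1 hn9 hG p
  · have hη : etaMink p q = 0 := by simp [etaMink, hpq]
    rw [hη, neg_zero, zero_mul, zero_add]
    exact sq2_hodge_of_ne n hn1 hn9 hG p q hpq
end

section
/- Let u₀, R, α', g_s > 0 and set m₀ = √(u₀/R³), M_KK = (3/2) m₀, and T_s defined by 2π α' T_s = (u₀/R)^{3/2}. Evaluate the Hagedorn coefficients with d = 2, φ₂ = 9/(16 m₀ R³), G̃₂ = 9/(8 m₀ R³), G̃₄ = 9/(128 (m₀ R³)²), g̃₂ = 11/(4 m₀ R³), and R̂₀ = −2·(9/(8 m₀ R³)). Then c₀ · α'^{1/2} = −M_KK/√(2π T_s) and c̃₁ · α' = ((8 log 2 − 1)/4)·(M_KK/√(2π T_s))², so that for the Witten–Yang–Mills model β_H² = (4π/T_s)·(1 − M_KK/√(2π T_s) + ((8 log 2 − 1)/4)(M_KK/√(2π T_s))² + …). -/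
/-- The confining string tension in terms of `m₀ = √(u₀/R³)`. -/
lemma rpow_three_halves_eq_of_sq_mul {u R m : ℝ} (hR : 0 < R) (hm : 0 < m)
    (h : m ^ 2 * R ^ 3 = u) : (u / R) ^ ((3 : ℝ) / 2) = m ^ 3 * R ^ 3 := by
  have hsq : u / R = (m * R) ^ (2 : ℝ) := by
    rw [Real.rpow_ofNat, ← h]
    field_simp
  rw [hsq, ← Real.rpow_mul (by positivity), show (2 : ℝ) * (3 / 2) = (3 : ℕ) by norm_num,
    Real.rpow_natCast, mul_pow]

/-- Hagedorn temperature of the Witten–Yang–Mills model to NNLO.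
With `m₀ = √(u₀/R³)`, `M_KK = (3/2)m₀`, `2πα'T_s = (u₀/R)^{3/2}`, and the Hagedorn
coefficients (for `d = 2`) evaluated at `φ₂ = 9/(16m₀R³)`, `G̃₂ = 9/(8m₀R³)`,
`G̃₄ = 9/(128(m₀R³)²)`, `g̃₂ = 11/(4m₀R³)`, `R̂₀ = −2·9/(8m₀R³)`:
`c₀ α'^{1/2} = −M_KK/√(2πT_s)` and
`c̃₁ α' = ((8 log 2 − 1)/4)(M_KK/√(2πT_s))²`, so that
`β_H² = (4π/T_s)(1 − M_KK/√(2πT_s) + ((8 log 2 − 1)/4)(M_KK/√(2πT_s))² + …)`. -/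
theorem stmt17 (u₀ R α' g_s m₀ MKK Ts : ℝ)
    (hu₀ : 0 < u₀) (hR : 0 < R) (hα' : 0 < α') (hgs : 0 < g_s)
    (hm₀ : m₀ = Real.sqrt (u₀ / R^3))
    (hMKK : MKK = (3/2) * m₀)
    (hTs : 2 * Real.pi * α' * Ts = (u₀/R) ^ ((3:ℝ)/2))
    (φ₂ G₂ G₄ g₂ R₀ c₀ c₁ ct₁ : ℝ)
    (hφ₂ : φ₂ = 9/(16*m₀*R^3))
    (hG₂ : G₂ = 9/(8*m₀*R^3))
    (hG₄ : G₄ = 9/(128*(m₀*R^3)^2))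
    (hg₂ : g₂ = 11/(4*m₀*R^3))
    (hR₀ : R₀ = -2 * (9/(8*m₀*R^3)))
    (hc₀ : c₀ = -((2:ℝ)/Real.sqrt 2) * G₂ ^ ((1:ℝ)/2))
    (hc₁ : c₁ = -((2:ℝ)*((2:ℝ)+2)/8) * (G₄/G₂) - ((2:ℝ)/2) * (g₂ - 2*φ₂)
        + ((2:ℝ)^2/4) * G₂)
    (hct₁ : ct₁ = c₁ - 2*R₀*Real.log 2) :
    c₀ * Real.sqrt α' = - MKK / Real.sqrt (2 * Real.pi * Ts)
    ∧ ct₁ * α' = ((8*Real.log 2 - 1)/4) * (MKK / Real.sqrt (2 * Real.pi * Ts))^2 := by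
  have hm : 0 < m₀ := hm₀ ▸ Real.sqrt_pos.mpr (by positivity)
  have hu : m₀ ^ 2 * R ^ 3 = u₀ := by
    rw [hm₀, Real.sq_sqrt (by positivity)]
    field_simp
  rw [rpow_three_halves_eq_of_sq_mul hR hm hu] at hTs
  have hT : 2 * Real.pi * Ts = m₀ ^ 3 * R ^ 3 / α' := by
    rw [eq_div_iff hα'.ne', ← hTs]
    ring
  have hratio : (MKK / Real.sqrt (2 * Real.pi * Ts)) ^ 2 = 9 * α' / (4 * m₀ * R ^ 3) := by
    rw [hT, div_pow, Real.sq_sqrt (by positivity), hMKK]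
    field_simp
    norm_num
  have hratio_nonneg : 0 ≤ MKK / Real.sqrt (2 * Real.pi * Ts) := by
    rw [hMKK]
    positivity
  constructor
  · rw [neg_div, ← Real.sqrt_sq hratio_nonneg, hratio, hc₀, Real.div_sqrt, ← Real.sqrt_eq_rpow,
      neg_mul, neg_mul, neg_inj, ← Real.sqrt_mul (by norm_num),
      ← Real.sqrt_mul (by rw [hG₂]; positivity), hG₂]
    congr 1
    field_simp
    norm_num
  · rw [hratio, hct₁, hc₁, hR₀, hg₂, hφ₂, hG₄, hG₂]
    field_simp
    ring
end

section
/- Let 0 ≤ λ < 1. Evaluate the Hagedorn coefficients with d = 2, G̃₂ = 1 − λ², G̃₄ = (1 − λ²)/3, G̃₆ = 2(1 − λ²)/45, g̃₂ = 2/3, g̃₄ = 2/15, φ₂ = φ₄ = 0, and R̂₀ = −2(1 − λ²). Then c₀ = −√(2(1 − λ²)), c̃₁ = 4(1 − λ²) log 2 − λ², and c̃₂ = −(2λ⁴ + 48(1 − λ²)² log 2 − 3)/(2^{5/2} √(1 − λ²)). (These are the coefficients of β_H² = (4π/T_s)(1 + c₀ α'^{1/2} + c̃₁ α' + c̃₂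 α'^{3/2} + …) for strings on AdS₃ with mixed RR and NSNS flux parameter λ; the NNLO and NNNLO terms are new results of the paper.) -/
theorem rpow_three_halves_eq {x : ℝ} (hx : 0 < x) : x ^ ((3:ℝ)/2) = x * Real.sqrt x := by
  rw [show (3:ℝ)/2 = 1 + 1/2 by norm_num, Real.rpow_add hx, Real.rpow_one, Real.sqrt_eq_rpow]

theorem rpow_five_halves_eq {x : ℝ} (hx : 0 < x) : x ^ ((5:ℝ)/2) = x ^ 2 * Real.sqrt x := by
  rw [show (5:ℝ)/2 = (2:ℕ) + 1/2 by norm_num, Real.rpow_add hx, Real.rpow_natCast,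
    Real.sqrt_eq_rpow]

/-- Hagedorn coefficients for `AdS₃` with mixed RR/NSNS flux `λ`.
For `0 ≤ λ < 1`, evaluating the Hagedorn coefficients (with `d = 2`) at
`G̃₂ = 1−λ²`, `G̃₄ = (1−λ²)/3`, `G̃₆ = 2(1−λ²)/45`, `g̃₂ = 2/3`, `g̃₄ = 2/15`,
`φ₂ = φ₄ = 0`, `R̂₀ = −2(1−λ²)` gives `c₀ = −√(2(1−λ²))`,
`c̃₁ = 4(1−λ²) log 2 − λ²` and
`c̃₂ = −(2λ⁴ + 48(1−λ²)² log 2 − 3)/(2^{5/2}√(1−λ²))`. -/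
theorem stmt18 (lam : ℝ) (hlam0 : 0 ≤ lam) (hlam1 : lam < 1)
    (G₂ G₄ G₆ g₂ g₄ φ₂ φ₄ R₀ c₀ c₁ c₂ ct₁ ct₂ : ℝ)
    (hG₂ : G₂ = 1 - lam^2) (hG₄ : G₄ = (1 - lam^2)/3) (hG₆ : G₆ = 2*(1 - lam^2)/45)
    (hg₂ : g₂ = 2/3) (hg₄ : g₄ = 2/15)
    (hφ₂ : φ₂ = 0) (hφ₄ : φ₄ = 0) (hR₀ : R₀ = -2*(1 - lam^2))
    (hc₀ : c₀ = -((2:ℝ)/Real.sqrt 2) * G₂ ^ ((1:ℝ)/2))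
    (hc₁ : c₁ = -((2:ℝ)*((2:ℝ)+2)/8) * (G₄/G₂) - ((2:ℝ)/2) * (g₂ - 2*φ₂)
        + ((2:ℝ)^2/4) * G₂)
    (hc₂ : c₂ =
      -((2:ℝ)*((2:ℝ)+2)*((2:ℝ)+4)/(16*Real.sqrt 2)) * G₆ / G₂ ^ ((3:ℝ)/2)
      + ((2:ℝ)*(10+9*(2:ℝ)+2*(2:ℝ)^2)/(32*Real.sqrt 2)) * G₄^2 / G₂ ^ ((5:ℝ)/2)
      - ((2:ℝ)*((2:ℝ)+2)/(2*Real.sqrt 2)) * (G₄*φ₂) / G₂ ^ ((3:ℝ)/2)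
      + ((2:ℝ)^2*((2:ℝ)+2)/(16*Real.sqrt 2)) * G₄ / G₂ ^ ((1:ℝ)/2)
      + ((2:ℝ)/Real.sqrt 2) * φ₂^2 / G₂ ^ ((1:ℝ)/2)
      + ((2:ℝ)*((2:ℝ)+1)/(4*Real.sqrt 2)) * g₂^2 / G₂ ^ ((1:ℝ)/2)
      + ((2:ℝ)^2/(4*Real.sqrt 2)) * g₂ * G₂ ^ ((1:ℝ)/2)
      + ((2:ℝ)*((2:ℝ)+2)/(2*Real.sqrt 2)) * (φ₄ - g₄) / G₂ ^ ((1:ℝ)/2)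
      - ((2:ℝ)^3/(16*Real.sqrt 2)) * G₂ ^ ((3:ℝ)/2))
    (hct₁ : ct₁ = c₁ - 2*R₀*Real.log 2)
    (hct₂ : ct₂ = c₂ + (3/Real.sqrt 2)*(2:ℝ)*(G₂ ^ ((1:ℝ)/2))*R₀*Real.log 2) :
    c₀ = - Real.sqrt (2*(1 - lam^2))
    ∧ ct₁ = 4*(1 - lam^2)*Real.log 2 - lam^2
    ∧ ct₂ = -(2*lam^4 + 48*(1 - lam^2)^2*Real.log 2 - 3)
          / ((2:ℝ) ^ ((5:ℝ)/2) * Real.sqrt (1 - lam^2)) := by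
  have hG : 0 < 1 - lam^2 := by nlinarith
  have h2 : (Real.sqrt 2)^2 = 2 := Real.sq_sqrt (by norm_num)
  have h2pos : 0 < Real.sqrt 2 := Real.sqrt_pos.mpr (by norm_num)
  have hs : (Real.sqrt (1 - lam^2))^2 = 1 - lam^2 := Real.sq_sqrt hG.le
  have hspos : 0 < Real.sqrt (1 - lam^2) := Real.sqrt_pos.mpr hG
  rw [← hG₂] at hG hG₄ hG₆ hR₀ hs hspos ⊢
  have hlam : lam^2 = 1 - G₂ := by linarith
  have hlam4 : lam^4 = (1 - G₂)^2 := by rw [← hlam]; ring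
  rw [rpow_three_halves_eq hG, rpow_five_halves_eq hG, ← Real.sqrt_eq_rpow] at hc₂
  rw [← Real.sqrt_eq_rpow] at hc₀ hct₂
  rw [rpow_five_halves_eq two_pos, hlam, hlam4]
  clear hG₂ hlam hlam4
  subst hG₄ hG₆ hg₂ hg₄ hφ₂ hφ₄ hR₀ hc₀ hc₁ hc₂ hct₁ hct₂
  refine ⟨?_, ?_, ?_⟩
  · rw [Real.sqrt_mul zero_le_two]
    field_simp
    linear_combination h2
  · field_simp
    ring
  · generalize Real.sqrt G₂ = s at *
    generalize Real.sqrt 2 = t at *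
    subst hs
    field_simp
    ring
end
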